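/- Let X be a subprojective real Banach space, let λ be an ordinal, let K be a compact Hausdorff space that is sequentially compact, and let φ : K → [0,λ] be a continuous surjection, where [0,λ] is the set of ordinals at most λ with the order topology. Then the subspace Z = { g ∘ φ : g ∈ C([0,λ], X) } is a closed subspace of C(K,X) and is subprojective with respect to C(K,X). -/

import Mathlib

/-- A real normed space `X` is *subprojective* if every closed infinite-dimensional
subspace of `X` contains an infinite-dimensional closed subspace that is
complemented in `X`. -/
def Subprojective (X : Type*) [NormedAddCommGroup X] [NormedSpace ℝ X] : Prop :=
  ∀ M : Submodule ℝ X, IsClosed (M : Set X) → ¬ FiniteDimensional ℝ M →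
    ∃ N : Submodule ℝ X, N ≤ M ∧ IsClosed (N : Set X) ∧ ¬ FiniteDimensional ℝ N ∧
      N.ClosedComplemented

/-- A subspace `Z` of `X` is *subprojective with respect to `X`* if every closed
infinite-dimensional subspace of `Z` contains an infinite-dimensional closed
subspace that is complemented in `X`. -/
def SubprojectiveWrt {X : Type*} [NormedAddCommGroup X] [NormedSpace ℝ X]
    (Z : Submodule ℝ X) : Prop :=
  ∀ M : Submodule ℝ X, M ≤ Z → IsClosed (M : Set X) → ¬ FiniteDimensional ℝ M →
    ∃ N : Submodule ℝ X, N ≤ M ∧ IsClosed (N : Set X) ∧ ¬ FiniteDimensional ℝ N ∧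
      N.ClosedComplemented

/-- The subspace `{ g ∘ φ : g ∈ C(L, X) }` of `C(K, X)`. -/
def compSubmodule {K L : Type*} [TopologicalSpace K] [TopologicalSpace L]
    (X : Type*) [NormedAddCommGroup X] [NormedSpace ℝ X] (φ : C(K, L)) :
    Submodule ℝ C(K, X) where
  carrier := { f | ∃ g : C(L, X), f = g.comp φ }
  add_mem' := by rintro f₁ f₂ ⟨g₁, rfl⟩ ⟨g₂, rfl⟩; exact ⟨g₁ + g₂, by ext k; simp⟩
  zero_mem' := ⟨0, by ext k; simp⟩
  smul_mem' := by rintro c f ⟨g, rfl⟩; exact ⟨c • g, by ext k; simp⟩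


open Filter Topology

namespace SubprojAux

section general

variable {E : Type*} [NormedAddCommGroup E] [NormedSpace ℝ E]

/-- A seminorm is bounded below on a subspace. -/
def BB (p : Seminorm ℝ E) (N : Submodule ℝ E) : Prop :=
  ∃ c : ℝ, 0 < c ∧ ∀ x ∈ N, c * ‖x‖ ≤ p x

theorem inf_ker_not_fd (N : Submodule ℝ E) (hN : ¬ FiniteDimensional ℝ N) (y : E →ₗ[ℝ] ℝ) :
    ¬ FiniteDimensional ℝ (N ⊓ LinearMap.ker y : Submodule ℝ E) := by
  intro h
  apply hN
  unfold FiniteDimensional at h ⊢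
  rw [Module.Finite.iff_fg] at h ⊢
  refine Submodule.fg_of_fg_map_of_fg_inf_ker y ?_ h
  exact IsNoetherian.noetherian _

theorem exists_inf_kers {ι : Type*} (s : Finset ι) (y : ι → E →L[ℝ] ℝ) (N : Submodule ℝ E)
    (hN : ¬ FiniteDimensional ℝ N) :
    ∃ N' ≤ N, ¬ FiniteDimensional ℝ N' ∧ ∀ i ∈ s, ∀ x ∈ N', y i x = 0 := by
  classical
  induction s using Finset.induction_on with
  | empty => exact ⟨N, le_rfl, hN, by simp⟩
  | insert i s _ ih =>
    obtain ⟨N', h1, h2, h3⟩ := ih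
    refine ⟨N' ⊓ LinearMap.ker (y i : E →ₗ[ℝ] ℝ), inf_le_left.trans h1,
      inf_ker_not_fd _ h2 _, ?_⟩
    intro j hj x hx
    rcases Finset.mem_insert.1 hj with rfl | hj
    · exact hx.2
    · exact h3 j hj x hx.1


theorem coeff_bound' (x : ℕ → E) (y : ℕ → E →L[ℝ] ℝ) (hy : ∀ n, ‖y n‖ ≤ 1) (hx : ∀ n, ‖x n‖ ≤ 1)
    (hyx : ∀ n, y n (x n) = 1) (h0 : ∀ m n, m < n → y m (x n) = 0) (a : ℕ → ℝ) (n : ℕ) :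
    ∀ k < n, |a k| ≤ 2 ^ k * ‖∑ j ∈ Finset.range n, a j • x j‖ := by
  intro k
  induction k using Nat.strong_induction_on with
  | _ k ih =>
  intro hk
  set v := ∑ j ∈ Finset.range n, a j • x j with hv
  have h1 : y k v = ∑ j ∈ Finset.range k, a j * y k (x j) + a k := by
    rw [hv, map_sum, ← Finset.sum_range_add_sum_Ico _ (show k + 1 ≤ n from hk),
      Finset.sum_range_succ, Finset.sum_eq_zero (s := Finset.Ico _ _)]
    · simp [hyx]
    · intro j hj
      rw [Finset.mem_Ico] at hj
      simp [h0 k j (by omega)]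
  have h2 : |y k v| ≤ ‖v‖ := by
    simpa using (y k).le_of_opNorm_le (hy k) v
  have h3 : |∑ j ∈ Finset.range k, a j * y k (x j)| ≤ ∑ j ∈ Finset.range k, 2 ^ j * ‖v‖ := by
    refine (Finset.abs_sum_le_sum_abs _ _).trans (Finset.sum_le_sum fun j hj => ?_)
    rw [Finset.mem_range] at hj
    have h4 : |y k (x j)| ≤ 1 := by
      have := (y k).le_of_opNorm_le (hy k) (x j)
      rw [Real.norm_eq_abs] at this
      linarith [hx j]
    rw [abs_mul]
    have := ih j hj (hj.trans hk)
    nlinarith [abs_nonneg (a j)]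
  rw [← Finset.sum_mul, geom_sum_eq (by norm_num)] at h3
  have h5 : a k = y k v - ∑ j ∈ Finset.range k, a j * y k (x j) := by rw [h1]; ring
  rw [h5]
  refine (abs_sub _ _).trans ?_
  norm_num at h3
  linarith

theorem sum_pow_le (n : ℕ) : ∑ k ∈ Finset.range n, (1 / 2 : ℝ) ^ k ≤ 2 := by
  have := sum_le_hasSum (Finset.range n) (fun i _ => by positivity) hasSum_geometric_two
  simpa using this

theorem not_fd_span (x : ℕ → E) (hx : LinearIndependent ℝ x) :
    ¬ FiniteDimensional ℝ (Submodule.span ℝ (Set.range x)) := by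
  intro h
  have := (linearIndependent_span hx).finite
  exact not_finite ℕ

theorem exists_small (p : Seminorm ℝ E) (N : Submodule ℝ E) (hN : ¬ FiniteDimensional ℝ N)
    (h : ∀ N' ≤ N, ¬ FiniteDimensional ℝ N' → ¬ BB p N') (ε : ℝ) (hε : 0 < ε) :
    ∃ N' ≤ N, ¬ FiniteDimensional ℝ N' ∧ ∀ x ∈ N', p x ≤ ε * ‖x‖ := by
  classical
  obtain ⟨f, hP, hr⟩ := exists_seq_of_forall_finset_exists
    (α := E × (E →L[ℝ] ℝ) × ℕ)
    (fun a => a.1 ∈ N ∧ ‖a.1‖ = 1 ∧ ‖a.2.1‖ ≤ 1 ∧ a.2.1 a.1 = 1 ∧ p a.1 ≤ ε / 4 ^ (a.2.2 + 1))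
    (fun a b => a.2.1 b.1 = 0 ∧ a.2.2 < b.2.2) (by
      intro s _
      obtain ⟨N', h1, h2, h3⟩ := exists_inf_kers s (fun a => a.2.1) N hN
      have h4 := h N' h1 h2
      unfold BB at h4
      push Not at h4
      set i := s.sup (fun a => a.2.2) + 1 with hi
      obtain ⟨x, hx, hpx⟩ := h4 (ε / 4 ^ (i + 1)) (by positivity)
      have hx0 : 0 < ‖x‖ := by
        by_contra hc
        have : ‖x‖ = 0 := le_antisymm (not_lt.1 hc) (norm_nonneg _)
        rw [this, mul_zero] at hpx
        linarith [apply_nonneg p x]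
      have hn : ‖(‖x‖⁻¹ • x)‖ = 1 := by
        rw [norm_smul, norm_inv, norm_norm, inv_mul_cancel₀ hx0.ne']
      obtain ⟨g, hg1, hg2⟩ := exists_dual_vector'' ℝ (‖x‖⁻¹ • x)
      refine ⟨(‖x‖⁻¹ • x, g, i), ⟨N.smul_mem _ (h1 hx), hn, hg1, ?_, ?_⟩, ?_⟩
      · rw [hg2, hn]; simp
      · simp only [map_smul_eq_mul, norm_inv, norm_norm]
        rw [inv_mul_le_iff₀ hx0]
        linarith
      · intro a ha
        refine ⟨h3 a ha _ (N'.smul_mem _ hx), ?_⟩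
        have := Finset.le_sup (f := fun a : E × (E →L[ℝ] ℝ) × ℕ => a.2.2) ha
        simp only at this ⊢
        omega)
  have hmono : StrictMono (fun n => (f n).2.2) := fun m n hmn => (hr m n hmn).2
  have hcb := coeff_bound' (fun n => (f n).1) (fun n => (f n).2.1) (fun n => (hP n).2.2.1)
    (fun n => (hP n).2.1.le) (fun n => (hP n).2.2.2.1) (fun m n hmn => (hr m n hmn).1)
  have hli : LinearIndependent ℝ (fun n => (f n).1) := by
    rw [linearIndependent_iff']
    intro s g hg i hi
    obtain ⟨n, hn⟩ := s.exists_nat_subset_range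
    have := hcb (fun j => if j ∈ s then g j else 0) n i (Finset.mem_range.1 (hn hi))
    have h2 : ∑ j ∈ Finset.range n, (if j ∈ s then g j else 0) • (f j).1 = 0 := by
      rw [← hg, ← Finset.sum_subset hn]
      · exact Finset.sum_congr rfl fun j hj => by simp [hj]
      · intro j _ hj; simp [hj]
    simp only [h2, norm_zero, mul_zero, hi, if_true] at this
    exact abs_nonpos_iff.1 this
  refine ⟨_, ?_, not_fd_span _ hli, ?_⟩
  · rw [Submodule.span_le]
    rintro _ ⟨n, rfl⟩
    exact (hP n).1
  · intro v hv
    obtain ⟨c, hc⟩ := Finsupp.mem_span_range_iff_exists_finsupp.1 hv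
    obtain ⟨n, hn⟩ := c.support.exists_nat_subset_range
    rw [Finsupp.sum_of_support_subset _ hn _ (by simp)] at hc
    have h1 := hcb c n
    rw [hc] at h1
    calc p v = p (∑ j ∈ Finset.range n, c j • (f j).1) := by rw [hc]
      _ ≤ ∑ j ∈ Finset.range n, p (c j • (f j).1) := Finset.le_sum_of_subadditive p (map_zero p).le (map_add_le_add p) _ _
      _ ≤ ∑ j ∈ Finset.range n, (1 / 2 : ℝ) ^ j * (ε / 4 * ‖v‖) := by
          refine Finset.sum_le_sum fun j hj => ?_
          rw [map_smul_eq_mul, Real.norm_eq_abs]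
          have h2 : p (f j).1 ≤ ε / 4 ^ (j + 1) := by
            refine (hP j).2.2.2.2.trans ?_
            gcongr
            · norm_num
            · exact hmono.le_apply
          calc |c j| * p (f j).1 ≤ (2 ^ j * ‖v‖) * (ε / 4 ^ (j + 1)) := by
                gcongr
                exact h1 j (Finset.mem_range.1 hj)
            _ = _ := by
                rw [one_div, inv_pow, pow_succ, show (4 : ℝ) = 2 * 2 by norm_num, mul_pow]
                field_simp
      _ ≤ 2 * (ε / 4 * ‖v‖) := by
          rw [← Finset.sum_mul]
          gcongr
          exact sum_pow_le n
      _ ≤ ε * ‖v‖ := by nlinarith [norm_nonneg v, mul_nonneg hε.le (norm_nonneg v)]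

theorem BB_add (p q : Seminorm ℝ E) (N : Submodule ℝ E) (hN : ¬ FiniteDimensional ℝ N)
    (h : BB (p + q) N) :
    ∃ N' ≤ N, ¬ FiniteDimensional ℝ N' ∧ (BB p N' ∨ BB q N') := by
  by_cases hp : ∀ N' ≤ N, ¬ FiniteDimensional ℝ N' → ¬ BB p N'
  · obtain ⟨c, hc, h⟩ := h
    obtain ⟨N', h1, h2, h3⟩ := exists_small p N hN hp (c / 2) (by positivity)
    refine ⟨N', h1, h2, Or.inr ⟨c / 2, by positivity, fun x hx => ?_⟩⟩
    have := h x (h1 hx)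
    have h4 := h3 x hx
    rw [add_apply] at this
    linarith
  · push Not at hp
    obtain ⟨N', h1, h2, h3⟩ := hp
    exact ⟨N', h1, h2, Or.inl h3⟩

end general

section compl

open ZeroAtInfty

variable {E : Type*} [NormedAddCommGroup E] [NormedSpace ℝ E]

theorem compl_of_near {F : Type*} [NormedAddCommGroup F] [NormedSpace ℝ F] [CompleteSpace F]
    (hF : ¬ FiniteDimensional ℝ F) (J : F →L[ℝ] E) (T : E →L[ℝ] F)
    (h : ‖(1 : F →L[ℝ] F) - T.comp J‖ < 1) :
    IsClosed (J.range : Set E) ∧ ¬ FiniteDimensional ℝ J.range ∧ J.range.ClosedComplemented := by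
  have hu := isUnit_one_sub_of_norm_lt_one h
  rw [sub_sub_cancel] at hu
  obtain ⟨u, hu⟩ := hu
  have hl : Function.LeftInverse ((↑u⁻¹ : F →L[ℝ] F).comp T) J := by
    intro x
    have h1 : (↑u⁻¹ * ↑u : F →L[ℝ] F) = 1 := u.inv_mul
    rw [hu] at h1
    exact congrArg (fun S : F →L[ℝ] F => S x) h1
  have hc := J.closedComplemented_range_of_leftInverse _ hl
  refine ⟨hc.isClosed, ?_, hc⟩
  intro hfd
  apply hF
  exact Module.Finite.equiv (LinearEquiv.ofInjective (J : F →ₗ[ℝ] E) hl.injective).symm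

theorem not_fd_c0 : ¬ FiniteDimensional ℝ C₀(ℕ, ℝ) := by
  intro h
  classical
  let e : ℕ → C₀(ℕ, ℝ) := fun n => ⟨⟨Pi.single n 1, continuous_of_discreteTopology⟩, by
    rw [cocompact_eq_atTop]
    refine tendsto_const_nhds.congr' ?_
    filter_upwards [eventually_gt_atTop n] with m hm
    simp [hm.ne']⟩
  have he : ∀ n m, e n m = if m = n then 1 else 0 := fun n m => by
    change (Pi.single n 1 : ℕ → ℝ) m = _
    simp [Pi.single_apply]
  have hli : LinearIndependent ℝ e := by
    rw [linearIndependent_iff']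
    intro s g hg i hi
    have : (∑ j ∈ s, g j • e j) i = 0 := by rw [hg]; rfl
    have h2 : ∀ t : Finset ℕ, (∑ j ∈ t, g j • e j) i = ∑ j ∈ t, g j * e j i := by
      intro t
      induction t using Finset.induction_on with
      | empty => simp
      | insert a t ha ih => rw [Finset.sum_insert ha, Finset.sum_insert ha, ← ih]; simp
    rw [h2] at this
    simpa [he, hi] using this
  have := hli.finite
  exact not_finite ℕ

theorem c0_norm_le (a : C₀(ℕ, ℝ)) {B : ℝ} (hB : 0 ≤ B) (h : ∀ n, |a n| ≤ B) : ‖a‖ ≤ B := by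
  rw [← ZeroAtInftyContinuousMap.norm_toBCF_eq_norm]
  exact (BoundedContinuousFunction.norm_le hB).2 h

theorem c0_le_norm (a : C₀(ℕ, ℝ)) (n : ℕ) : |a n| ≤ ‖a‖ := by
  rw [← ZeroAtInftyContinuousMap.norm_toBCF_eq_norm]
  exact a.toBCF.norm_coe_le_norm n

theorem c0_lemma [CompleteSpace E] (f : ℕ → E) (h : ℕ → E →L[ℝ] ℝ) (C D : ℝ) (hC0 : 0 ≤ C)
    (hC : ∀ (F : Finset ℕ) (a : ℕ → ℝ) (B : ℝ), 0 ≤ B → (∀ n ∈ F, |a n| ≤ B) →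
      ‖∑ n ∈ F, a n • f n‖ ≤ C * B)
    (hT : ∀ e, Tendsto (fun n => h n e) atTop (𝓝 0)) (hD : ∀ n e, |h n e| ≤ D * ‖e‖)
    (hδ : ∀ n m, |(if n = m then 1 else 0) - h n (f m)| ≤ (1 / 4) * (1 / 2 : ℝ) ^ m)
    (M : Submodule ℝ E) (hM : IsClosed (M : Set E)) (hf : ∀ n, f n ∈ M) :
    ∃ N : Submodule ℝ E, N ≤ M ∧ IsClosed (N : Set E) ∧ ¬ FiniteDimensional ℝ N ∧
      N.ClosedComplemented := by
  have hD0 : ∀ e : E, 0 ≤ D * ‖e‖ := fun e => (abs_nonneg _).trans (hD 0 e)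
  have hsum : ∀ a : C₀(ℕ, ℝ), Summable (fun n => a n • f n) := by
    intro a
    rw [summable_iff_vanishing_norm]
    intro ε hε
    have ha : Tendsto (fun n => a n) atTop (𝓝 0) := by
      have := a.zero_at_infty'
      rwa [cocompact_eq_atTop] at this
    have hε' : 0 < ε / (C + 1) := by positivity
    obtain ⟨n, hn⟩ := Metric.tendsto_atTop.1 ha _ hε'
    refine ⟨Finset.range n, fun t ht => ?_⟩
    refine (hC t a (ε / (C + 1)) hε'.le fun m hm => ?_).trans_lt ?_
    · have : n ≤ m := by
        by_contra hc
        exact Finset.disjoint_left.1 ht hm (Finset.mem_range.2 (not_le.1 hc))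
      simpa using (hn m this).le
    · rw [mul_div_assoc', div_lt_iff₀ (by positivity)]
      nlinarith
  let J0 : C₀(ℕ, ℝ) →ₗ[ℝ] E :=
    { toFun := fun a => ∑' n, a n • f n
      map_add' := fun a b => by
        rw [← (hsum a).tsum_add (hsum b)]
        simp [add_smul]
      map_smul' := fun c a => by
        simp only [RingHom.id_apply]
        rw [← (hsum a).tsum_const_smul]
        simp [smul_smul] }
  let J : C₀(ℕ, ℝ) →L[ℝ] E := J0.mkContinuous C (fun a => by
    refine le_of_tendsto ((hsum a).hasSum.norm) (Eventually.of_forall fun F => ?_)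
    exact hC F a _ (norm_nonneg _) fun n _ => c0_le_norm a n)
  have hJ : ∀ a, HasSum (fun n => a n • f n) (J a) := fun a => (hsum a).hasSum
  let T0 : E →ₗ[ℝ] C₀(ℕ, ℝ) :=
    { toFun := fun e => ⟨⟨fun n => h n e, continuous_of_discreteTopology⟩, by
        rw [cocompact_eq_atTop]; exact hT e⟩
      map_add' := fun a b => by ext n; exact map_add (h n) a b
      map_smul' := fun c a => by ext n; exact map_smul (h n) c a }
  let T : E →L[ℝ] C₀(ℕ, ℝ) := T0.mkContinuous D (fun e =>
    c0_norm_le _ (hD0 e) fun n => hD n e)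
  have hTa : ∀ e n, T e n = h n e := fun e n => rfl
  have hnear : ‖(1 : C₀(ℕ, ℝ) →L[ℝ] C₀(ℕ, ℝ)) - T.comp J‖ < 1 := by
    refine lt_of_le_of_lt (ContinuousLinearMap.opNorm_le_bound _ (M := 1 / 2) (by norm_num) ?_)
      (by norm_num)
    intro a
    refine c0_norm_le _ (by positivity) fun n => ?_
    change |a n - T (J a) n| ≤ _
    rw [hTa]
    have h1 : HasSum (fun m => a m * h n (f m)) (h n (J a)) := by
      have := (h n).hasSum (hJ a)
      simpa using this
    have h2 : HasSum (fun m => a m * (if n = m then 1 else 0)) (a n) := by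
      have := hasSum_single (f := fun m => a m * (if n = m then (1 : ℝ) else 0)) n
        (fun m hm => by simp [hm.symm])
      simpa using this
    have h3 := h2.sub h1
    have h4 : HasSum (fun m => ‖a‖ * ((1 / 4) * (1 / 2 : ℝ) ^ m)) (‖a‖ * ((1 / 4) * 2)) :=
      (hasSum_geometric_two.mul_left _).mul_left _
    have h5 := h3.norm_le_of_bounded h4 (fun m => by
      rw [← mul_sub, norm_mul, Real.norm_eq_abs, Real.norm_eq_abs]
      exact mul_le_mul (c0_le_norm a m) (hδ n m) (abs_nonneg _) (norm_nonneg _))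
    rw [Real.norm_eq_abs] at h5
    linarith
  obtain ⟨h1, h2, h3⟩ := compl_of_near not_fd_c0 J T hnear
  refine ⟨J.range, ?_, h1, h2, h3⟩
  rintro _ ⟨a, rfl⟩
  exact hM.mem_of_tendsto (hJ a) (Eventually.of_forall fun F =>
    M.sum_mem fun n _ => M.smul_mem _ (hf n))

theorem ev_case [CompleteSpace E] {X : Type*} [NormedAddCommGroup X] [NormedSpace ℝ X]
    [CompleteSpace X] (hX : Subprojective X) (e : E →L[ℝ] X)
    (M : Submodule ℝ E) (hM : IsClosed (M : Set E)) (N : Submodule ℝ E) (hNM : N ≤ M)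
    (hN : ¬ FiniteDimensional ℝ N) (c : ℝ) (hc : 0 < c) (hb : ∀ x ∈ N, c * ‖x‖ ≤ ‖e x‖) :
    ∃ N : Submodule ℝ E, N ≤ M ∧ IsClosed (N : Set E) ∧ ¬ FiniteDimensional ℝ N ∧
      N.ClosedComplemented := by
  let V := N.topologicalClosure
  have hVM : V ≤ M := N.topologicalClosure_minimal hNM hM
  have hV : IsClosed (V : Set E) := N.isClosed_topologicalClosure
  have hVfd : ¬ FiniteDimensional ℝ V := fun h =>
    hN (Submodule.finiteDimensional_of_le N.le_topologicalClosure)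
  have hVb : ∀ x ∈ V, c * ‖x‖ ≤ ‖e x‖ := by
    intro x hx
    have hcl : IsClosed {x : E | c * ‖x‖ ≤ ‖e x‖} :=
      isClosed_le (by fun_prop) (by fun_prop)
    exact closure_minimal (fun x hx => hb x hx) hcl hx
  have : CompleteSpace V := hV.completeSpace_coe
  let g : V →L[ℝ] X := e.comp V.subtypeL
  have hanti : AntilipschitzWith (Real.toNNReal c⁻¹) g := by
    refine AddMonoidHomClass.antilipschitz_of_bound g fun x => ?_
    rw [Real.coe_toNNReal _ (by positivity)]
    have := hVb x x.2
    rw [inv_mul_eq_div, le_div_iff₀ hc, mul_comm]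
    exact this
  have hinj := hanti.injective
  have hcl : IsClosed (Set.range g) := hanti.isClosed_range g.uniformContinuous
  let q := g.equivRange hinj hcl
  obtain ⟨W, hW1, hW2, hW3, P, hP⟩ := hX g.range hcl (fun h =>
    hVfd (Module.Finite.equiv (q.symm : g.range ≃ₗ[ℝ] V)))
  have : CompleteSpace W := hW2.completeSpace_coe
  let i : W →L[ℝ] g.range := W.subtypeL.codRestrict g.range (fun w => hW1 w.2)
  let J : W →L[ℝ] E := V.subtypeL.comp ((q.symm : g.range →L[ℝ] V).comp i)
  have hJ : ∀ w : W, e (J w) = w := by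
    intro w
    have h1 : g (q.symm (i w)) = q (q.symm (i w)) := rfl
    rw [q.apply_symm_apply] at h1
    exact h1
  have hnear : ‖(1 : W →L[ℝ] W) - (P.comp e).comp J‖ < 1 := by
    have : (1 : W →L[ℝ] W) - (P.comp e).comp J = 0 := by
      ext w
      simp [hJ, hP]
    rw [this]
    exact lt_of_eq_of_lt ContinuousLinearMap.opNorm_zero one_pos
  obtain ⟨h1, h2, h3⟩ := compl_of_near hW3 J (P.comp e) hnear
  refine ⟨J.range, ?_, h1, h2, h3⟩
  rintro _ ⟨a, rfl⟩
  exact hVM (q.symm (i a)).2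

end compl

section main

variable {X : Type*} [NormedAddCommGroup X] [NormedSpace ℝ X]
variable {K : Type*} [TopologicalSpace K]

/-- Sup seminorm over a compact subset. -/
noncomputable def resSN (X : Type*) [NormedAddCommGroup X] [NormedSpace ℝ X]
    (S : Set K) [CompactSpace S] [CompactSpace K] : Seminorm ℝ C(K, X) :=
  (normSeminorm ℝ C(S, X)).comp (σ₁₂ := RingHom.id ℝ)
    { toFun := fun f => f.restrict S
      map_add' := fun _ _ => rfl
      map_smul' := fun _ _ => rfl }

theorem resSN_apply (S : Set K) [CompactSpace S] [CompactSpace K] (f : C(K, X)) :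
    resSN X S f = ‖f.restrict S‖ := rfl

theorem le_resSN (S : Set K) [CompactSpace S] [CompactSpace K] (f : C(K, X)) {s : K}
    (hs : s ∈ S) : ‖f s‖ ≤ resSN X S f :=
  (f.restrict S).norm_coe_le_norm ⟨s, hs⟩

theorem resSN_le (S : Set K) [CompactSpace S] [CompactSpace K] (f : C(K, X)) {B : ℝ}
    (hB : 0 ≤ B) (h : ∀ s ∈ S, ‖f s‖ ≤ B) : resSN X S f ≤ B :=
  (ContinuousMap.norm_le _ hB).2 fun s => h s s.2

/-- Evaluation as a continuous linear map. -/
noncomputable def ev (X : Type*) [NormedAddCommGroup X] [NormedSpace ℝ X] [CompactSpace K]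
    (t : K) : C(K, X) →L[ℝ] X :=
  LinearMap.mkContinuous
    { toFun := fun f => f t
      map_add' := fun _ _ => rfl
      map_smul' := fun _ _ => rfl } 1 (fun f => by
        rw [one_mul]; exact f.norm_coe_le_norm t)

theorem ev_apply [CompactSpace K] (t : K) (f : C(K, X)) : ev X t f = f t := rfl

/-- Evaluation seminorm. -/
noncomputable def evSN (X : Type*) [NormedAddCommGroup X] [NormedSpace ℝ X] [CompactSpace K]
    (t : K) : Seminorm ℝ C(K, X) :=
  (normSeminorm ℝ X).comp (ev X t : C(K, X) →ₗ[ℝ] X)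

theorem evSN_apply [CompactSpace K] (t : K) (f : C(K, X)) : evSN X t f = ‖f t‖ := rfl

/-- Error terms. -/
noncomputable def err (n : ℕ) : ℝ := (1 / 16) * (1 / 2 : ℝ) ^ n

theorem err_pos (n : ℕ) : 0 < err n := by unfold err; positivity

theorem err_lt_one (n : ℕ) : err n < 1 := by
  unfold err
  have : (1 / 2 : ℝ) ^ n ≤ 1 := pow_le_one₀ (by norm_num) (by norm_num)
  linarith

theorem err_anti {m n : ℕ} (h : m ≤ n) : err n ≤ err m := by
  unfold err
  have : (1 / 2 : ℝ) ^ n ≤ (1 / 2 : ℝ) ^ m :=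
    pow_le_pow_of_le_one (by norm_num) (by norm_num) h
  linarith

theorem sum_err_le (F : Finset ℕ) : ∑ n ∈ F, err n ≤ 1 := by
  have := sum_le_hasSum F (fun i _ => (err_pos i).le) (hasSum_geometric_two.mul_left (1 / 16))
  norm_num at this
  linarith

theorem block_lemma [CompactSpace K] [SeqCompactSpace K] [CompleteSpace X]
    (S : Set K) [CompactSpace S]
    (M N : Submodule ℝ C(K, X)) (hM : IsClosed (M : Set C(K, X))) (hNM : N ≤ M)
    (c : ℝ) (hc : 0 < c) (hN : ∀ f ∈ N, c * ‖f‖ ≤ resSN X S f)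
    (f : ℕ → C(K, X)) (t : ℕ → K) (hf : ∀ n, f n ∈ N) (hf1 : ∀ n, ∀ s ∈ S, ‖f n s‖ ≤ 1)
    (ht : ∀ n, ‖f n (t n)‖ = 1) (htS : ∀ n, t n ∈ S)
    (hlt : ∀ m n, m < n → ∀ s ∈ S, ‖f m s‖ ≤ err m ∨ ‖f n s‖ ≤ err n)
    (t0 : K) (hlim : Tendsto t atTop (𝓝 t0)) :
    ∃ N : Submodule ℝ C(K, X), N ≤ M ∧ IsClosed (N : Set C(K, X)) ∧ ¬ FiniteDimensional ℝ N ∧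
      N.ClosedComplemented := by
  have hne : ∀ m n, m ≠ n → ∀ s ∈ S, ‖f m s‖ ≤ err m ∨ ‖f n s‖ ≤ err n := by
    intro m n hmn s hs
    rcases lt_or_gt_of_ne hmn with h | h
    · exact hlt m n h s hs
    · exact (hlt n m h s hs).symm
  have hoff : ∀ m n, m ≠ n → ‖f m (t n)‖ ≤ err m := by
    intro m n hmn
    rcases hne m n hmn _ (htS n) with h | h
    · exact h
    · rw [ht] at h
      linarith [err_lt_one n]
  have hoff0 : ∀ m, ‖f m t0‖ ≤ err m := by
    intro m
    have h1 : Tendsto (fun n => ‖f m (t n)‖) atTop (𝓝 ‖f m t0‖) :=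
      (((f m).continuous.tendsto t0).comp hlim).norm
    refine le_of_tendsto h1 ?_
    filter_upwards [eventually_gt_atTop m] with n hn
    exact hoff m n hn.ne
  choose y hy1 hy2 using fun n => exists_dual_vector'' ℝ (f n (t n))
  have hyle : ∀ n v, |y n v| ≤ ‖v‖ := fun n v => by
    simpa using (y n).le_of_opNorm_le (hy1 n) v
  let h : ℕ → C(K, X) →L[ℝ] ℝ := fun n => (y n).comp (ev X (t n) - ev X t0)
  have hh : ∀ n e, h n e = y n (e (t n) - e t0) := fun n e => rfl
  refine c0_lemma f h (2 / c) 2 (by positivity) ?_ ?_ ?_ ?_ M hM (fun n => hNM (hf n))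
  · intro F a B hB ha
    have hmem : ∑ n ∈ F, a n • f n ∈ N := N.sum_mem fun n _ => N.smul_mem _ (hf n)
    have h1 := hN _ hmem
    have h2 : resSN X S (∑ n ∈ F, a n • f n) ≤ 2 * B := by
      refine resSN_le _ _ (by positivity) fun s hs => ?_
      obtain ⟨n0, hn0⟩ : ∃ n0, ∀ n, ‖f n s‖ ≤ (if n = n0 then 1 else 0) + err n := by
        by_cases hex : ∃ n0, err n0 < ‖f n0 s‖
        · obtain ⟨n0, hn0⟩ := hex
          refine ⟨n0, fun n => ?_⟩
          split_ifs with hnn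
          · linarith [hf1 n s hs, err_pos n]
          · rcases hne n n0 hnn s hs with h | h
            · linarith
            · linarith
        · push Not at hex
          refine ⟨0, fun n => (hex n).trans ?_⟩
          split_ifs <;> linarith
      have h3 : (∑ n ∈ F, a n • f n) s = ∑ n ∈ F, a n • f n s := by
        rw [← ev_apply, map_sum]; rfl
      rw [h3]
      calc ‖∑ n ∈ F, a n • f n s‖ ≤ ∑ n ∈ F, B * ((if n = n0 then 1 else 0) + err n) := by
            refine (norm_sum_le _ _).trans (Finset.sum_le_sum fun n hn => ?_)
            rw [norm_smul, Real.norm_eq_abs]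
            exact mul_le_mul (ha n hn) (hn0 n) (norm_nonneg _) hB
        _ = B * ((∑ n ∈ F, if n = n0 then 1 else 0) + ∑ n ∈ F, err n) := by
            rw [← Finset.mul_sum, Finset.sum_add_distrib]
        _ ≤ B * (1 + 1) := by
            gcongr
            · rw [Finset.sum_ite_eq']
              split_ifs <;> norm_num
            · exact sum_err_le F
        _ = 2 * B := by ring
    rw [div_mul_eq_mul_div, le_div_iff₀ hc]
    linarith
  · intro e
    have h1 : Tendsto (fun n => ‖e (t n) - e t0‖) atTop (𝓝 0) := by
      have : Tendsto (fun n => ‖e (t n) - e t0‖) atTop (𝓝 ‖e t0 - e t0‖) :=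
        (((e.continuous.tendsto t0).comp hlim).sub_const _).norm
      simpa using this
    exact squeeze_zero_norm (fun n => by rw [hh]; exact hyle n _) h1
  · intro n e
    rw [hh]
    refine (hyle n _).trans ((norm_sub_le _ _).trans ?_)
    linarith [e.norm_coe_le_norm (t n), e.norm_coe_le_norm t0]
  · intro n m
    have he : err m = (1 / 16) * (1 / 2 : ℝ) ^ m := rfl
    have hpos := err_pos m
    have h0 := (hyle n (f m t0)).trans (hoff0 m)
    rw [hh, map_sub]
    split_ifs with hnm
    · subst hnm
      rw [hy2, ht]
      simp only [RCLike.ofReal_real_eq_id, id_eq]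
      rw [sub_sub_cancel]
      linarith
    · have h1 := (hyle n (f m (t n))).trans (hoff m n (Ne.symm hnm))
      rw [zero_sub, abs_neg]
      refine (abs_sub _ _).trans ?_
      linarith

theorem main_lemma [CompactSpace K] [SeqCompactSpace K] [CompleteSpace X]
    (hX : Subprojective X) {L : Type*} [LinearOrder L] [TopologicalSpace L] [OrderTopology L]
    [WellFoundedLT L] [OrderTop L] (φ : C(K, L)) (hφ : Function.Surjective φ)
    (M : Submodule ℝ C(K, X)) (hMZ : M ≤ compSubmodule X φ) (hM : IsClosed (M : Set C(K, X)))
    (hMfd : ¬ FiniteDimensional ℝ M) :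
    ∃ N : Submodule ℝ C(K, X), N ≤ M ∧ IsClosed (N : Set C(K, X)) ∧ ¬ FiniteDimensional ℝ N ∧
      N.ClosedComplemented := by
  classical
  by_cases hev : ∃ t : K, ∃ N ≤ M, ¬ FiniteDimensional ℝ N ∧ BB (evSN X t) N
  · obtain ⟨t, N, hNM, hN, c, hc, hb⟩ := hev
    exact ev_case hX (ev X t) M hM N hNM hN c hc hb
  push Not at hev
  have hcomp : ∀ ν : L, CompactSpace {k | φ k ≤ ν} := fun ν =>
    isCompact_iff_compactSpace.1 (isClosed_le φ.continuous continuous_const).isCompact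
  have hne : ∃ ν : L, ∃ N ≤ M, ¬ FiniteDimensional ℝ N ∧ BB (resSN X {k | φ k ≤ ν}) N := by
    refine ⟨⊤, M, le_rfl, hMfd, 1, one_pos, fun f _ => ?_⟩
    rw [one_mul]
    exact (ContinuousMap.norm_le _ (apply_nonneg _ _)).2 fun s => le_resSN _ f (by simp)
  obtain ⟨μ, ⟨N, hNM, hNfd, c, hc, hb⟩, hmin⟩ :
      ∃ μ : L, (∃ N ≤ M, ¬ FiniteDimensional ℝ N ∧ BB (resSN X {k | φ k ≤ μ}) N) ∧
        ∀ ν < μ, ¬ ∃ N ≤ M, ¬ FiniteDimensional ℝ N ∧ BB (resSN X {k | φ k ≤ ν}) N := by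
    let A : Set L := {ν | ∃ N ≤ M, ¬ FiniteDimensional ℝ N ∧ BB (resSN X {k | φ k ≤ ν}) N}
    have hA : A.Nonempty := hne
    have hwf : WellFounded ((· < ·) : L → L → Prop) := wellFounded_lt
    obtain ⟨μ, h1, h2⟩ := hwf.has_min A hA
    exact ⟨μ, h1, fun ν hν h => h2 ν h hν⟩
  obtain ⟨k0, hk0⟩ := hφ μ
  have hbot : ∃ ν, ν < μ := by
    by_contra hcon
    push Not at hcon
    refine hev k0 N hNM hNfd ⟨c, hc, fun f hf => (hb f hf).trans ?_⟩
    refine resSN_le _ _ (norm_nonneg _) fun s hs => ?_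
    obtain ⟨g, rfl⟩ := hMZ (hNM hf)
    have : φ s = φ k0 := by rw [hk0]; exact le_antisymm hs (hcon _)
    rw [evSN_apply, ContinuousMap.comp_apply, ContinuousMap.comp_apply, this]
  have hq : ∀ ν < μ, ∀ ε > 0, ∃ f ∈ N,
      resSN X {k | φ k ≤ ν} f + ‖f k0‖ < ε * ‖f‖ := by
    intro ν hν ε hε
    by_contra hcon
    push Not at hcon
    obtain ⟨N', h1, h2, h3⟩ := BB_add (resSN X {k | φ k ≤ ν}) (evSN X k0) N hNfd
      ⟨ε, hε, fun f hf => hcon f hf⟩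
    rcases h3 with h3 | h3
    · exact hmin ν hν ⟨N', h1.trans hNM, h2, h3⟩
    · exact hev k0 N' (h1.trans hNM) h2 h3
  obtain ⟨F, hP, hr⟩ := exists_seq_of_forall_finset_exists
    (α := C(K, X) × K × ℕ)
    (fun a => a.1 ∈ N ∧ (∀ s, φ s ≤ μ → ‖a.1 s‖ ≤ 1) ∧ ‖a.1 a.2.1‖ = 1 ∧ φ a.2.1 ≤ μ ∧
      ∃ ν < μ, ∀ s, ν < φ s → φ s ≤ μ → ‖a.1 s‖ ≤ err a.2.2)
    (fun a b => a.2.2 < b.2.2 ∧ ∀ s, φ s ≤ μ → ‖a.1 s‖ ≤ err a.2.2 ∨ ‖b.1 s‖ ≤ err b.2.2) (by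
      intro A hA
      obtain ⟨ν, hν, hνA⟩ : ∃ ν < μ, ∀ a ∈ A, ∀ s, ν < φ s → φ s ≤ μ → ‖a.1 s‖ ≤ err a.2.2 := by
        induction A using Finset.induction_on with
        | empty => obtain ⟨ν, hν⟩ := hbot; exact ⟨ν, hν, by simp⟩
        | insert a A _ ih =>
          obtain ⟨ν, hν, h1⟩ := ih fun x hx => hA x (Finset.mem_insert_of_mem hx)
          obtain ⟨_, _, _, _, ν', hν', h2⟩ := hA a (Finset.mem_insert_self _ _)
          refine ⟨max ν ν', max_lt hν hν', fun b hb s hs => ?_⟩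
          rcases Finset.mem_insert.1 hb with rfl | hb
          · exact h2 s ((le_max_right _ _).trans_lt hs)
          · exact h1 b hb s ((le_max_left _ _).trans_lt hs)
      set i := A.sup (fun a => a.2.2) + 1 with hi
      obtain ⟨f, hfN, hf⟩ := hq ν hν (c * err i) (mul_pos hc (err_pos i))
      have hf' := hb f hfN
      set r := resSN X {k | φ k ≤ μ} f with hrdef
      have hlt : resSN X {k | φ k ≤ ν} f + ‖f k0‖ < err i * r := by
        refine hf.trans_le ?_
        nlinarith [err_pos i]
      have hr0 : 0 < r := by
        have h0 : 0 ≤ resSN X {k | φ k ≤ ν} f + ‖f k0‖ :=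
          add_nonneg (apply_nonneg _ _) (norm_nonneg _)
        by_contra hcon
        nlinarith [err_pos i]
      have hsc : ∀ s, ‖(r⁻¹ • f) s‖ = r⁻¹ * ‖f s‖ := fun s => by
        rw [ContinuousMap.smul_apply, norm_smul, norm_inv, Real.norm_eq_abs, abs_of_pos hr0]
      obtain ⟨t, ht, htm⟩ : ∃ t, φ t ≤ μ ∧ ‖f t‖ = r := by
        have hcpt : IsCompact {k | φ k ≤ μ} := isCompact_iff_compactSpace.2 inferInstance
        obtain ⟨t, ht, hmax⟩ := hcpt.exists_isMaxOn ⟨k0, hk0.le⟩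
          (f.continuous.norm.continuousOn)
        exact ⟨t, ht, le_antisymm (le_resSN _ f ht)
          (resSN_le _ _ (norm_nonneg _) fun s hs => hmax hs)⟩
      refine ⟨(r⁻¹ • f, t, i), ⟨N.smul_mem _ hfN, ?_, ?_, ht, ?_⟩, ?_⟩
      · intro s hs
        rw [hsc, inv_mul_le_iff₀ hr0, mul_one]
        exact le_resSN _ f hs
      · rw [hsc, htm, inv_mul_cancel₀ hr0.ne']
      · obtain ⟨g, hg⟩ := hMZ (hNM hfN)
        have hU : {x | ‖g x‖ < err i * r} ∈ 𝓝 μ := by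
          refine (isOpen_lt (by fun_prop) continuous_const).mem_nhds ?_
          have h1 : ‖f k0‖ < err i * r :=
            lt_of_le_of_lt (le_add_of_nonneg_left (apply_nonneg _ _)) hlt
          rw [hg, ContinuousMap.comp_apply, hk0] at h1
          exact h1
        obtain ⟨ν', hν', hsub⟩ := exists_Ioc_subset_of_mem_nhds hU hbot
        refine ⟨ν', hν', fun s hs1 hs2 => ?_⟩
        have h1 : ‖g (φ s)‖ < err i * r := hsub ⟨hs1, hs2⟩
        rw [hsc, inv_mul_le_iff₀ hr0, hg, ContinuousMap.comp_apply, mul_comm]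
        exact h1.le
      · intro a ha
        have := Finset.le_sup (f := fun a : C(K, X) × K × ℕ => a.2.2) ha
        refine ⟨by simp only at this ⊢; omega, fun s hs => ?_⟩
        by_cases hs' : φ s ≤ ν
        · right
          rw [hsc, inv_mul_le_iff₀ hr0, mul_comm]
          have h1 : ‖f s‖ ≤ resSN X {k | φ k ≤ ν} f := le_resSN _ f hs'
          linarith [norm_nonneg (f k0)]
        · left
          exact hνA a ha s (not_le.1 hs') hs)
  obtain ⟨t0, ψ, hψ, hlim⟩ := SeqCompactSpace.tendsto_subseq (fun n => (F n).2.1)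
  have hmono : StrictMono (fun n => (F n).2.2) := fun m n hmn => (hr m n hmn).1
  have hle : ∀ n, err (F (ψ n)).2.2 ≤ err n := fun n => err_anti (hmono.comp hψ).le_apply
  refine block_lemma {k | φ k ≤ μ} M N hM hNM c hc hb (fun n => (F (ψ n)).1)
    (fun n => (F (ψ n)).2.1) (fun n => (hP _).1) (fun n => (hP _).2.1) (fun n => (hP _).2.2.1)
    (fun n => (hP _).2.2.2.1) ?_ t0 hlim
  intro m n hmn s hs
  exact ((hr _ _ (hψ hmn)).2 s hs).imp (fun h => h.trans (hle m)) (fun h => h.trans (hle n))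

theorem closed_lemma [CompactSpace K] [CompleteSpace X] {L : Type*} [TopologicalSpace L]
    (φ : C(K, L)) (hφ : Function.Surjective φ) :
    IsClosed ((compSubmodule X φ : Submodule ℝ C(K, X)) : Set C(K, X)) := by
  have : CompactSpace L := hφ.compactSpace φ.continuous
  have hiso : Isometry (fun g : C(L, X) => g.comp φ) := by
    refine Isometry.of_dist_eq fun g g' => ?_
    refine le_antisymm ?_ ?_
    · exact (ContinuousMap.dist_le dist_nonneg).2 fun k => ContinuousMap.dist_apply_le_dist (φ k)
    · refine (ContinuousMap.dist_le dist_nonneg).2 fun x => ?_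
      obtain ⟨k, rfl⟩ := hφ x
      exact ContinuousMap.dist_apply_le_dist (f := g.comp φ) (g := g'.comp φ) k
  have h := hiso.isClosedEmbedding.isClosed_range
  have heq : ((compSubmodule X φ : Submodule ℝ C(K, X)) : Set C(K, X)) =
      Set.range (fun g : C(L, X) => g.comp φ) := by
    ext f
    exact ⟨fun ⟨g, hg⟩ => ⟨g, hg.symm⟩, fun ⟨g, hg⟩ => ⟨g, hg.symm⟩⟩
  rw [heq]
  exact h

end main

end SubprojAux

theorem subprojectiveWrt_compSubmodule
    (X : Type*) [NormedAddCommGroup X] [NormedSpace ℝ X] [CompleteSpace X]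
    (hX : Subprojective X) (l : Ordinal)
    (K : Type*) [TopologicalSpace K] [CompactSpace K] [T2Space K] [SeqCompactSpace K]
    (φ : C(K, Set.Iic l)) (hφ : Function.Surjective φ) :
    IsClosed ((compSubmodule X φ : Submodule ℝ C(K, X)) : Set C(K, X)) ∧
      SubprojectiveWrt (compSubmodule X φ) := by
  exact ⟨SubprojAux.closed_lemma φ hφ, fun M hMZ hM hMfd =>
    SubprojAux.main_lemma hX φ hφ M hMZ hM hMfd⟩
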